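/- Let f : S^3 → ℝ^3 be a continuous odd map. Then f has a zero, and moreover there exist two distinct points p₁, p₂ ∈ S^3 with p₁ ≠ -p₂ and f(p₁) = f(p₂). -/

import Mathlib

namespace BU
open Finsupp

abbrev Ch (V : Type*) := List V →₀ ZMod 2

noncomputable def cone {V : Type*} (b : V) : Ch V →ₗ[ZMod 2] Ch V :=
  Finsupp.lmapDomain _ _ (List.cons b)

noncomputable def bdL {V : Type*} : List V → Ch V
  | [] => 0
  | a :: l => single l 1 + cone a (bdL l)

noncomputable def bd {V : Type*} : Ch V →ₗ[ZMod 2] Ch V :=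
  Finsupp.linearCombination (ZMod 2) bdL

noncomputable def push {V W : Type*} (g : V → W) : Ch V →ₗ[ZMod 2] Ch W :=
  Finsupp.lmapDomain _ _ (List.map g)

lemma cone_single {V : Type*} (b : V) (l : List V) :
    cone b (single l 1) = single (b :: l) 1 := by
  simp [cone, Finsupp.mapDomain_single]

lemma push_single {V W : Type*} (g : V → W) (l : List V) :
    push g (single l 1) = single (l.map g) 1 := by
  simp [push, Finsupp.mapDomain_single]

lemma bd_single {V : Type*} (l : List V) : bd (single l 1) = bdL l := by
  simp [bd]

lemma lin_ext {V M : Type*} [AddCommGroup M] [Module (ZMod 2) M]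
    (S T : Ch V →ₗ[ZMod 2] M) (h : ∀ l, S (single l 1) = T (single l 1)) (x : Ch V) :
    S x = T x := by
  have : S = T := by
    apply Finsupp.lhom_ext'
    intro l
    apply LinearMap.ext_ring
    simpa using h l
  rw [this]

lemma ch_add_self {V : Type*} (x : Ch V) : x + x = 0 := by
  ext l
  simpa using CharTwo.add_self_eq_zero (x l)

lemma bd_cone {V : Type*} (b : V) (x : Ch V) : bd (cone b x) = x + cone b (bd x) := by
  refine lin_ext (bd ∘ₗ cone b) (LinearMap.id + cone b ∘ₗ bd) (fun l => ?_) x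
  simp only [LinearMap.comp_apply, LinearMap.add_apply, LinearMap.id_apply, cone_single,
    bd_single, bdL]

lemma bd_bd {V : Type*} (x : Ch V) : bd (bd x) = 0 := by
  refine lin_ext (bd ∘ₗ bd) 0 (fun l => ?_) x
  simp only [LinearMap.comp_apply, LinearMap.zero_apply, bd_single]
  induction l with
  | nil => simp [bdL]
  | cons a l ih =>
    simp only [bdL, map_add, bd_single, bd_cone, ih, map_zero, add_zero, ch_add_self]

lemma push_cone {V W : Type*} (g : V → W) (b : V) (x : Ch V) :
    push g (cone b x) = cone (g b) (push g x) := by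
  refine lin_ext (push g ∘ₗ cone b) (cone (g b) ∘ₗ push g) (fun l => ?_) x
  simp only [LinearMap.comp_apply, cone_single, push_single, List.map_cons]

lemma push_bd {V W : Type*} (g : V → W) (x : Ch V) :
    push g (bd x) = bd (push g x) := by
  refine lin_ext (push g ∘ₗ bd) (bd ∘ₗ push g) (fun l => ?_) x
  simp only [LinearMap.comp_apply, push_single, bd_single]
  induction l with
  | nil => simp [bdL]
  | cons a l ih =>
    simp only [bdL, List.map_cons, map_add, push_single, push_cone, ih]

lemma supp_map {V M : Type*} [AddCommGroup M] [Module (ZMod 2) M]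
    (T : Ch V →ₗ[ZMod 2] M) (S : Set (List V)) (N : Submodule (ZMod 2) M)
    (h : ∀ l ∈ S, T (single l 1) ∈ N) {x : Ch V} (hx : x ∈ supported (ZMod 2) (ZMod 2) S) :
    T x ∈ N := by
  rw [Finsupp.supported_eq_span_single] at hx
  have : Submodule.span (ZMod 2) ((fun i => single i (1 : ZMod 2)) '' S) ≤ N.comap T := by
    rw [Submodule.span_le]
    rintro _ ⟨l, hl, rfl⟩
    exact h l hl
  exact this hx

lemma supp_eq {V M : Type*} [AddCommGroup M] [Module (ZMod 2) M]
    (S T : Ch V →ₗ[ZMod 2] M) (A : Set (List V))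
    (h : ∀ l ∈ A, S (single l 1) = T (single l 1)) {x : Ch V}
    (hx : x ∈ supported (ZMod 2) (ZMod 2) A) : S x = T x := by
  have := supp_map (S - T) A ⊥ (fun l hl => by simp [h l hl]) hx
  simpa [sub_eq_zero] using this

lemma single_mem {V : Type*} {S : Set (List V)} {l : List V} (h : l ∈ S) :
    (single l 1 : Ch V) ∈ supported (ZMod 2) (ZMod 2) S :=
  Finsupp.single_mem_supported _ _ h

lemma bdL_supp {V : Type*} (l : List V) :
    bdL l ∈ supported (ZMod 2) (ZMod 2) {l' : List V | l'.length + 1 = l.length ∧ l' ⊆ l} := by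
  induction l with
  | nil => simp [bdL]
  | cons a l ih =>
    refine Submodule.add_mem _ (single_mem ?_) ?_
    · simp
    · refine supp_map (cone a) _ _ (fun l' hl' => ?_) ih
      rw [cone_single]
      apply single_mem
      obtain ⟨h1, h2⟩ := hl'
      refine ⟨by simp [h1], ?_⟩
      exact List.cons_subset_cons a h2

abbrev E := EuclideanSpace ℝ (Fin 4)

noncomputable def bary (l : List E) : E := (l.length : ℝ)⁻¹ • l.sum

noncomputable def Sd : ℕ → Ch E →ₗ[ZMod 2] Ch E
  | 0 => LinearMap.id
  | n + 1 => Finsupp.linearCombination (ZMod 2) (fun l => cone (bary l) (Sd n (bdL l)))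

lemma Sd_succ_single (n : ℕ) (l : List E) :
    Sd (n+1) (single l 1) = cone (bary l) (Sd n (bdL l)) := by
  simp [Sd]

lemma bd_Sd (n : ℕ) (x : Ch E) : bd (Sd (n+1) x) = Sd n (bd x) := by
  induction n generalizing x with
  | zero =>
    refine lin_ext (bd ∘ₗ Sd 1) (Sd 0 ∘ₗ bd) (fun l => ?_) x
    simp only [LinearMap.comp_apply, Sd_succ_single, bd_cone]
    simp [Sd, ← bd_single, bd_bd]
  | succ n ih =>
    refine lin_ext (bd ∘ₗ Sd (n+2)) (Sd (n+1) ∘ₗ bd) (fun l => ?_) x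
    simp only [LinearMap.comp_apply, Sd_succ_single (n+1), bd_cone, ih]
    simp [← bd_single, bd_bd]

noncomputable def ng : Ch E →ₗ[ZMod 2] Ch E := push (fun v => -v)

lemma bary_neg (l : List E) : bary (l.map (fun v => -v)) = - bary l := by
  have : (l.map (fun v => -v)).sum = - l.sum := by
    induction l with
    | nil => simp
    | cons a l ih => simp only [List.map_cons, List.sum_cons, ih]; abel
  simp [bary, this]

lemma ng_Sd (n : ℕ) (x : Ch E) : ng (Sd n x) = Sd n (ng x) := by
  induction n generalizing x with
  | zero => rfl
  | succ n ih =>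
    refine lin_ext (ng ∘ₗ Sd (n+1)) (Sd (n+1) ∘ₗ ng) (fun l => ?_) x
    simp only [LinearMap.comp_apply, Sd_succ_single]
    have h1 : ng (single l 1) = single (l.map (fun v => -v)) 1 := push_single _ _
    rw [h1, Sd_succ_single, bary_neg, ng, push_cone]
    have h2 := ih (bdL l)
    rw [ng] at h2
    rw [h2, ← bd_single, ← bd_single, push_bd, push_single]

def G (n : ℕ) (D : ℝ) (Q : Set E) : Set (List E) :=
  {l | l.length = n ∧ (∀ v ∈ l, v ∈ Q) ∧ ∀ u ∈ l, ∀ v ∈ l, dist u v ≤ D}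

lemma bary_eq (l : List E) : bary l = ∑ i : Fin l.length, (l.length : ℝ)⁻¹ • l.get i := by
  rw [← Finset.smul_sum, bary]
  congr 1
  simp

lemma bary_mem {Q : Set E} (hQ : Convex ℝ Q) (l : List E) (h0 : 0 < l.length)
    (h : ∀ v ∈ l, v ∈ Q) : bary l ∈ Q := by
  rw [bary_eq]
  apply hQ.sum_mem
  · intros; positivity
  · simp; field_simp
  · intro i _; exact h _ (List.get_mem l i)

lemma bary_dist (l : List E) (D : ℝ) (hl : l.length ≤ 4)
    (h : ∀ u ∈ l, ∀ v ∈ l, dist u v ≤ D) (v : E) (hv : v ∈ l) : dist v (bary l) ≤ 3/4 * D := by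
  obtain ⟨i, rfl⟩ := List.mem_iff_get.1 hv
  have hD : 0 ≤ D := le_trans dist_nonneg (h _ hv _ hv)
  have hN : (0:ℝ) < l.length := by
    have := i.pos
    exact_mod_cast this
  have e : bary l - l.get i = ∑ j : Fin l.length, (l.length : ℝ)⁻¹ • (l.get j - l.get i) := by
    simp_rw [smul_sub]
    rw [Finset.sum_sub_distrib, ← bary_eq]
    congr 1
    simp only [Finset.sum_const, Finset.card_univ, Fintype.card_fin]
    rw [← Nat.cast_smul_eq_nsmul ℝ, smul_smul, mul_inv_cancel₀ hN.ne', one_smul]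
  rw [dist_comm, dist_eq_norm, e]
  calc ‖∑ j : Fin l.length, (l.length : ℝ)⁻¹ • (l.get j - l.get i)‖
      ≤ ∑ j : Fin l.length, (l.length : ℝ)⁻¹ * (if j = i then 0 else D) := by
        refine (norm_sum_le _ _).trans (Finset.sum_le_sum fun j _ => ?_)
        rw [norm_smul, Real.norm_of_nonneg (by positivity)]
        gcongr
        split_ifs with hji
        · simp [hji]
        · rw [← dist_eq_norm]
          exact h _ (List.get_mem l j) _ hv
    _ = (l.length : ℝ)⁻¹ * ((l.length - 1) * D) := by
        rw [← Finset.mul_sum]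
        congr 1
        have : ∀ j : Fin l.length, (if j = i then 0 else D) = D - (if j = i then D else 0) := by
          intro j; split_ifs <;> simp
        simp_rw [this, Finset.sum_sub_distrib]
        simp
        ring
    _ ≤ 3/4 * D := by
        have h4 : (l.length : ℝ) ≤ 4 := by exact_mod_cast hl
        rw [inv_mul_le_iff₀ hN]
        nlinarith

lemma Sd_small (n : ℕ) (hn : n ≤ 4) : ∀ (D : ℝ) (Q : Set E), Convex ℝ Q → ∀ l ∈ G n D Q,
    Sd n (single l 1) ∈ supported (ZMod 2) (ZMod 2) (G n (3/4*D) Q) := by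
  induction n with
  | zero =>
    intro D Q hQ l hl
    have : l = [] := List.length_eq_zero_iff.1 hl.1
    subst this
    apply single_mem
    simp [G]
  | succ n ih =>
    intro D Q hQ l hl
    obtain ⟨h1, h2, h3⟩ := hl
    rw [Sd_succ_single]
    have hlen : 0 < l.length := by omega
    have hb := bary_mem hQ l hlen h2
    have hd := bary_dist l D (by omega) h3
    have hD : 0 ≤ D := by
      have := l.get_mem ⟨0, hlen⟩
      exact le_trans dist_nonneg (h3 _ this _ this)
    set Q' : Set E := Q ∩ Metric.closedBall (bary l) (3/4*D) with hQ'
    have hcQ' : Convex ℝ Q' := hQ.inter (convex_closedBall _ _)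
    have k1 : Sd n (bdL l) ∈ supported (ZMod 2) (ZMod 2) (G n (3/4*D) Q') := by
      refine supp_map (Sd n) _ _ (fun l' hl' => ?_) (bdL_supp l)
      obtain ⟨hl1, hl2⟩ := hl'
      apply ih (by omega) D Q' hcQ'
      refine ⟨by omega, fun v hv => ⟨h2 v (hl2 hv), hd v (hl2 hv)⟩, fun u hu v hv =>
        h3 u (hl2 hu) v (hl2 hv)⟩
    refine supp_map (cone (bary l)) _ _ (fun τ hτ => ?_) k1
    rw [cone_single]
    apply single_mem
    obtain ⟨t1, t2, t3⟩ := hτ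
    refine ⟨by simp [t1], ?_, ?_⟩
    · intro v hv
      rcases List.mem_cons.1 hv with rfl | hv
      · exact hb
      · exact (t2 v hv).1
    · intro u hu v hv
      rcases List.mem_cons.1 hu with rfl | hu <;> rcases List.mem_cons.1 hv with rfl | hv
      · simpa using hD
      · rw [dist_comm]; exact (t2 v hv).2
      · exact (t2 u hu).2
      · exact t3 u hu v hv


/-! Cross-polytope chains -/

noncomputable def e (k : ℕ) : E := WithLp.toLp 2 (fun i : Fin 4 => if i.val = k then 1 else 0)

lemma e_apply (k : ℕ) (i : Fin 4) : e k i = if i.val = k then 1 else 0 := rfl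

noncomputable def c : ℕ → Ch E
  | 0 => single [e 0] 1
  | k + 1 => cone (e (k+1)) (c k + ng (c k))

lemma ng_ng (x : Ch E) : ng (ng x) = x := by
  refine lin_ext (ng ∘ₗ ng) LinearMap.id (fun l => ?_) x
  simp [ng, push_single]

lemma bd_c_zero : bd (c 0) = single [] 1 := by
  simp [c, bd_single, bdL]

lemma bd_z (k : ℕ) : bd (c k + ng (c k)) = 0 ∧ bd (c (k+1)) = c k + ng (c k) := by
  have key : ∀ k, bd (c k + ng (c k)) = 0 → bd (c (k+1)) = c k + ng (c k) := by
    intro k h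
    rw [c, bd_cone, h, map_zero, add_zero]
  have h0 : ∀ k, bd (c k + ng (c k)) = 0 := by
    intro k
    induction k with
    | zero =>
      rw [map_add]
      have : bd (ng (c 0)) = ng (bd (c 0)) := (push_bd _ _).symm
      rw [this, bd_c_zero, ng, push_single]
      exact ch_add_self _
    | succ k ih =>
      rw [map_add]
      have : bd (ng (c (k+1))) = ng (bd (c (k+1))) := (push_bd _ _).symm
      rw [this, key k ih, map_add, ng_ng, add_comm (ng (c k))]
      exact ch_add_self _
  exact ⟨h0 k, key k (h0 k)⟩

def I (k : ℕ) : Set (List E) := {l | l.length = k + 1 ∧ ∃ w : E, (∀ i : Fin 4, k < i.val → w i = 0) ∧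
  (∀ i, |w i| ≤ 1) ∧ ∀ v ∈ l, ‖v‖ = 1 ∧ (∀ i : Fin 4, k < i.val → v i = 0) ∧ ∑ i, w i * v i = 1}

lemma e_norm (k : ℕ) (hk : k < 4) : ‖e k‖ = 1 := by
  have : e k = EuclideanSpace.single (⟨k, hk⟩ : Fin 4) (1:ℝ) := by
    ext i
    simp [e_apply, Fin.ext_iff]
  rw [this]; simp

lemma I_neg (k : ℕ) (l : List E) (h : l ∈ I k) : l.map (fun v => -v) ∈ I k := by
  obtain ⟨h1, w, h2, h3, h4⟩ := h
  refine ⟨by simp [h1], -w, fun i hi => by simp [h2 i hi], fun i => by simpa using h3 i, ?_⟩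
  intro v hv
  obtain ⟨u, hu, rfl⟩ := List.mem_map.1 hv
  obtain ⟨a, b, d⟩ := h4 u hu
  exact ⟨by simpa using a, fun i hi => by simp [b i hi], by simpa using d⟩

lemma I_cone (k : ℕ) (hk : k + 1 < 4) (l : List E) (h : l ∈ I k) : e (k+1) :: l ∈ I (k+1) := by
  obtain ⟨h1, w, h2, h3, h4⟩ := h
  refine ⟨by simp [h1], w + e (k+1), fun i hi => ?_, fun i => ?_, ?_⟩
  · have := h2 i (by omega)
    simp [this, e_apply]
    omega
  · by_cases hi : i.val = k + 1
    · have := h2 i (by omega)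
      simp [this, e_apply, hi]
    · have := h3 i
      simpa [e_apply, hi] using this
  · intro v hv
    rcases List.mem_cons.1 hv with rfl | hv
    · refine ⟨e_norm _ hk, fun i hi => ?_, ?_⟩
      · simp [e_apply]; omega
      · have : ∀ i : Fin 4, (w + e (k+1)) i * e (k+1) i = if i = ⟨k+1, hk⟩ then 1 else 0 := by
          intro i
          by_cases hi : i.val = k + 1
          · have := h2 i (by omega)
            simp [this, e_apply, hi, Fin.ext_iff]
          · simp [e_apply, hi, Fin.ext_iff]
        simp_rw [this]
        simp
    · obtain ⟨a, b, d⟩ := h4 v hv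
      refine ⟨a, fun i hi => b i (by omega), ?_⟩
      rw [← d]
      refine Finset.sum_congr rfl fun i _ => ?_
      by_cases hi : i.val = k + 1
      · simp [b i (by omega)]
      · simp [e_apply, hi]

lemma c_supp (k : ℕ) (hk : k < 4) : c k ∈ supported (ZMod 2) (ZMod 2) (I k) := by
  induction k with
  | zero =>
    refine single_mem ⟨rfl, e 0, fun i hi => ?_, fun i => ?_, ?_⟩
    · simp [e_apply]; omega
    · simp only [e_apply]; split_ifs <;> simp
    · intro v hv
      simp only [List.mem_singleton] at hv
      subst hv
      refine ⟨e_norm 0 hk, fun i hi => ?_, ?_⟩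
      · simp [e_apply]; omega
      · simp [e_apply]
  | succ k ih =>
    have ih := ih (by omega)
    rw [c]
    refine supp_map (cone (e (k+1))) (I k) _ (fun l hl => ?_) (x := c k + ng (c k)) ?_
    · rw [cone_single]; exact single_mem (I_cone k hk l hl)
    · refine Submodule.add_mem _ ih (supp_map ng _ _ (fun l hl => ?_) ih)
      rw [ng, push_single]; exact single_mem (I_neg k l hl)

def Qs (w : E) : Set E := {v | ∑ i, w i * v i = 1} ∩ Metric.closedBall 0 1

lemma Qs_convex (w : E) : Convex ℝ (Qs w) := by
  refine Convex.inter ?_ (convex_closedBall _ _)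
  intro x hx y hy a b ha hb hab
  simp only [Set.mem_ofPred_eq] at *
  have : ∀ i, w i * (a • x + b • y) i = a * (w i * x i) + b * (w i * y i) := by
    intro i; simp; ring
  simp_rw [this, Finset.sum_add_distrib, ← Finset.mul_sum, hx, hy]
  simpa using hab

def J (n : ℕ) (D : ℝ) : Set (List E) := {l | ∃ w : E, (∀ i, |w i| ≤ 1) ∧ l ∈ G n D (Qs w)}

lemma I_sub_J (k : ℕ) : I k ⊆ J (k+1) 2 := by
  rintro l ⟨h1, w, h2, h3, h4⟩
  refine ⟨w, h3, h1, fun v hv => ⟨(h4 v hv).2.2, by simp [(h4 v hv).1]⟩, fun u hu v hv => ?_⟩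
  have a := (h4 u hu).1
  have b := (h4 v hv).1
  have := norm_sub_le u v
  rw [dist_eq_norm]; linarith

lemma Sd_J (n : ℕ) (hn : n ≤ 4) (D : ℝ) (x : Ch E)
    (hx : x ∈ supported (ZMod 2) (ZMod 2) (J n D)) :
    Sd n x ∈ supported (ZMod 2) (ZMod 2) (J n (3/4*D)) := by
  refine supp_map (Sd n) _ _ (fun l hl => ?_) hx
  obtain ⟨w, hw, hl⟩ := hl
  refine Finsupp.supported_mono ?_ (Sd_small n hn D _ (Qs_convex w) l hl)
  intro τ hτ
  exact ⟨w, hw, hτ⟩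

noncomputable def cm (m k : ℕ) : Ch E := (Sd (k+1))^[m] (c k)

lemma cm_supp (m k : ℕ) (hk : k < 4) :
    cm m k ∈ supported (ZMod 2) (ZMod 2) (J (k+1) ((3/4)^m * 2)) := by
  unfold cm
  induction m with
  | zero => simpa using Finsupp.supported_mono (I_sub_J k) (c_supp k hk)
  | succ m ih =>
    rw [Function.iterate_succ_apply', pow_succ']
    have := Sd_J (k+1) (by omega) _ _ ih
    rwa [← mul_assoc] at this

lemma bd_iter (n m : ℕ) (x : Ch E) : bd ((Sd (n+1))^[m] x) = (Sd n)^[m] (bd x) := by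
  induction m with
  | zero => rfl
  | succ m ih => rw [Function.iterate_succ_apply', Function.iterate_succ_apply', bd_Sd, ih]

lemma ng_iter (n m : ℕ) (x : Ch E) : ng ((Sd n)^[m] x) = (Sd n)^[m] (ng x) := by
  induction m with
  | zero => rfl
  | succ m ih => rw [Function.iterate_succ_apply', Function.iterate_succ_apply', ng_Sd, ih]

lemma add_iter (n m : ℕ) (x y : Ch E) :
    (Sd n)^[m] (x + y) = (Sd n)^[m] x + (Sd n)^[m] y := by
  induction m with
  | zero => rfl
  | succ m ih => simp only [Function.iterate_succ_apply', ih, map_add]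

lemma bd_cm_zero (m : ℕ) : bd (cm m 0) = single [] 1 := by
  rw [cm, bd_iter, bd_c_zero]
  induction m with
  | zero => rfl
  | succ m ih => rw [Function.iterate_succ_apply', ih]; rfl

lemma bd_cm_succ (m k : ℕ) : bd (cm m (k+1)) = cm m k + ng (cm m k) := by
  rw [cm, bd_iter, (bd_z k).2, add_iter, ← ng_iter]; rfl

def K : Set E := {v | 1/2 ≤ ‖v‖ ∧ ‖v‖ ≤ 1}

lemma J_K {n : ℕ} {D : ℝ} {l : List E} (h : l ∈ J n D) : ∀ v ∈ l, v ∈ K := by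
  obtain ⟨w, hw, -, h2, -⟩ := h
  intro v hv
  obtain ⟨h3, h4⟩ := h2 v hv
  refine ⟨?_, by simpa using h4⟩
  have hcs := Finset.sum_mul_sq_le_sq_mul_sq Finset.univ (fun i => w i) (fun i => v i)
  have e1 : ∑ i, w i * v i = 1 := h3
  rw [e1] at hcs
  have e2 : ∑ i, v i ^ 2 = ‖v‖^2 := by
    rw [EuclideanSpace.norm_sq_eq]; simp
  have e3 : ∑ i, w i ^ 2 ≤ 4 := by
    calc ∑ i, w i ^ 2 ≤ ∑ i : Fin 4, (1:ℝ) :=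
          Finset.sum_le_sum fun i _ => (sq_le_one_iff_abs_le_one _).2 (hw i)
      _ = 4 := by simp
  rw [e2] at hcs
  nlinarith [norm_nonneg v, sq_nonneg ‖v‖]

/-! Labels -/

abbrev L := Fin 3 × Bool

def fl (a : L) : L := (a.1, !a.2)

def altB : List L → Bool
  | [] => true
  | [a] => a.2
  | [a, b] => (a.1 < b.1 && a.2 && !b.2) || (b.1 < a.1 && b.2 && !a.2)
  | [a, b, c] => [a, b, c].contains (0, true) && [a, b, c].contains (1, false)
      && [a, b, c].contains (2, true)
  | _ => false

def altL (l : List L) : ZMod 2 := if altB l then 1 else 0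

noncomputable def alt : Ch L →ₗ[ZMod 2] ZMod 2 := Finsupp.linearCombination (ZMod 2) altL

lemma alt_single (l : List L) : alt (single l 1) = altL l := by simp [alt]

lemma dec1 : ∀ a : L, altL [] = altL [a] + altL [fl a] := by decide
lemma dec2 : ∀ a b : L, a ≠ fl b → altL [b] + altL [a] = altL [a, b] + altL [fl a, fl b] := by
  decide
lemma dec3 : ∀ a b c : L, a ≠ fl b → a ≠ fl c → b ≠ fl c →
    altL [b, c] + (altL [a, c] + altL [a, b]) = altL [a, b, c] + altL [fl a, fl b, fl c] := by
  decide +kernel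
lemma dec4 : ∀ a b c d : L, (a ≠ fl b ∧ a ≠ fl c ∧ a ≠ fl d ∧ b ≠ fl c ∧ b ≠ fl d ∧ c ≠ fl d) →
    altL [b, c, d] + (altL [a, c, d] + (altL [a, b, d] + altL [a, b, c]))
      = altL [a, b, c, d] + altL [fl a, fl b, fl c, fl d] := by
  decide +kernel

def NC (k : ℕ) : Set (List L) := {l | l.length = k + 1 ∧ ∀ a ∈ l, ∀ b ∈ l, a ≠ fl b}

lemma alt_bd_list (k : ℕ) (hk : k < 4) (l : List L) (hl : l ∈ NC k) :
    alt (bdL l) = altL l + altL (l.map fl) := by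
  obtain ⟨h1, h2⟩ := hl
  match l, h1, h2 with
  | [], h1, h2 => simp at h1
  | [a], h1, h2 => simp [bdL, alt_single, dec1 a]
  | [a, b], h1, h2 =>
    simp only [bdL, map_add, map_zero, add_zero, cone_single, alt_single, List.map]
    exact dec2 a b (h2 _ (by simp) _ (by simp))
  | [a, b, c], h1, h2 =>
    simp only [bdL, map_add, map_zero, add_zero, cone_single, alt_single, List.map]
    exact dec3 a b c (h2 _ (by simp) _ (by simp)) (h2 _ (by simp) _ (by simp))
      (h2 _ (by simp) _ (by simp))
  | [a, b, c, d], h1, h2 =>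
    simp only [bdL, map_add, map_zero, add_zero, cone_single, alt_single, List.map]
    apply dec4 a b c d
    refine ⟨?_, ?_, ?_, ?_, ?_, ?_⟩ <;> exact (h2 _ (by simp) _ (by simp))
  | a :: b :: c :: d :: f :: t, h1, h2 => simp at h1; omega

lemma alt_bd (k : ℕ) (hk : k < 4) (x : Ch L) (hx : x ∈ supported (ZMod 2) (ZMod 2) (NC k)) :
    alt (bd x) = alt (x + push fl x) := by
  refine supp_eq (alt ∘ₗ bd) (alt ∘ₗ (LinearMap.id + push fl)) (NC k) (fun l hl => ?_) hx
  simp only [LinearMap.comp_apply, LinearMap.add_apply, LinearMap.id_apply, bd_single,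
    push_single, map_add, alt_single]
  exact alt_bd_list k hk l hl

lemma no_label (lam : E → L) (δ : ℝ) (hδ : 0 < δ) (h1 : ∀ v ∈ K, lam (-v) = fl (lam v))
    (h2 : ∀ u ∈ K, ∀ v ∈ K, dist u v < δ → lam u ≠ fl (lam v)) : False := by
  obtain ⟨m, hm⟩ : ∃ m : ℕ, (3/4 : ℝ)^m < δ/2 :=
    exists_pow_lt_of_lt_one (by positivity) (by norm_num)
  set d : ℕ → Ch L := fun k => push lam (cm m k) with hd
  have hNC : ∀ k < 4, d k ∈ supported (ZMod 2) (ZMod 2) (NC k) := by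
    intro k hk
    refine supp_map (push lam) _ _ (fun l hl => ?_) (cm_supp m k hk)
    rw [push_single]
    apply single_mem
    have hK := J_K hl
    obtain ⟨w, -, g1, -, g3⟩ := hl
    refine ⟨by simp [g1], ?_⟩
    intro a ha b hb
    obtain ⟨u, hu, rfl⟩ := List.mem_map.1 ha
    obtain ⟨v, hv, rfl⟩ := List.mem_map.1 hb
    exact h2 u (hK u hu) v (hK v hv) (by linarith [g3 u hu v hv])
  have hng : ∀ k < 4, push lam (ng (cm m k)) = push fl (d k) := by
    intro k hk
    refine supp_eq (push lam ∘ₗ ng) (push fl ∘ₗ push lam) _ (fun l hl => ?_) (cm_supp m k hk)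
    simp only [LinearMap.comp_apply, ng, push_single, List.map_map]
    congr 1
    apply List.map_congr_left
    intro v hv
    exact h1 v (J_K hl v hv)
  have hbd : ∀ k, k + 1 < 4 → bd (d (k+1)) = d k + push fl (d k) := by
    intro k hk
    rw [← hng k (by omega), hd]
    simp only
    rw [← push_bd, bd_cm_succ, map_add]
  have hbd0 : bd (d 0) = single [] 1 := by
    rw [hd]
    simp only
    rw [← push_bd, bd_cm_zero, push_single]; rfl
  have key : ∀ k < 4, alt (d k + push fl (d k)) = 1 := by
    intro k hk
    induction k with
    | zero =>
      rw [← alt_bd 0 hk _ (hNC 0 hk), hbd0, alt_single]; rfl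
    | succ k ih =>
      rw [← alt_bd (k+1) hk _ (hNC (k+1) hk), hbd k hk]
      exact ih (by omega)
  have h3 : alt (d 3 + push fl (d 3)) = 0 := by
    refine supp_eq (alt ∘ₗ (LinearMap.id + push fl)) 0 (NC 3) (fun l hl => ?_)
      (hNC 3 (by norm_num))
    simp only [LinearMap.comp_apply, LinearMap.add_apply, LinearMap.id_apply,
      push_single, map_add, alt_single, LinearMap.zero_apply]
    obtain ⟨hl, -⟩ := hl
    match l, hl with
    | [a, b, c, d], _ => simp [altL, altB]
  rw [key 3 (by norm_num)] at h3
  exact one_ne_zero h3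

lemma K_compact : IsCompact K := by
  have : K = Metric.closedBall 0 1 ∩ {v | 1/2 ≤ ‖v‖} := by
    ext v; simp [K, and_comm]
  rw [this]
  exact (isCompact_closedBall _ _).inter_right (isClosed_le continuous_const continuous_norm)

lemma K_nonempty : K.Nonempty := ⟨e 0, by simp [K, e_norm 0 (by norm_num)]; norm_num⟩

abbrev E3 := EuclideanSpace ℝ (Fin 3)

lemma no_map (g : E → E3) (hg : ContinuousOn g K) (hodd : ∀ v ∈ K, g (-v) = - g v)
    (hne : ∀ v ∈ K, g v ≠ 0) : False := by
  obtain ⟨v0, hv0, hmin⟩ := K_compact.exists_isMinOn K_nonempty hg.norm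
  set ε := ‖g v0‖ with hε
  have hεpos : 0 < ε := norm_pos_iff.2 (hne v0 hv0)
  have hle : ∀ v ∈ K, ε ≤ ‖g v‖ := fun v hv => hmin hv
  have huc := K_compact.uniformContinuousOn_of_continuous hg
  rw [Metric.uniformContinuousOn_iff] at huc
  obtain ⟨δ, hδ, huc⟩ := huc ε hεpos
  set lam : E → L := fun v =>
    if ε/2 ≤ |g v 0| then (0, decide (0 < g v 0)) else
    if ε/2 ≤ |g v 1| then (1, decide (0 < g v 1)) else (2, decide (0 < g v 2)) with hlam
  have hlab : ∀ v ∈ K, ε/2 ≤ |g v (lam v).1| ∧ (lam v).2 = decide (0 < g v (lam v).1) := by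
    intro v hv
    by_cases h0 : ε/2 ≤ |g v 0|
    · simp [hlam, h0]
    by_cases h1 : ε/2 ≤ |g v 1|
    · simp [hlam, h0, h1]
    simp only [hlam, h0, h1, if_false, and_true]
    by_contra h2
    have hn : ‖g v‖^2 = g v 0 ^ 2 + g v 1 ^ 2 + g v 2 ^ 2 := by
      rw [EuclideanSpace.norm_sq_eq]; simp [Fin.sum_univ_three]
    have := hle v hv
    push Not at h0 h1 h2
    have a0 := sq_lt_sq' (neg_lt_of_abs_lt h0) (lt_of_abs_lt h0)
    have a1 := sq_lt_sq' (neg_lt_of_abs_lt h1) (lt_of_abs_lt h1)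
    have a2 := sq_lt_sq' (neg_lt_of_abs_lt h2) (lt_of_abs_lt h2)
    nlinarith
  apply no_label lam δ hδ
  · intro v hv
    have hK : -v ∈ K := by simpa [K] using hv
    have h1 : (lam (-v)).1 = (lam v).1 := by
      simp only [hlam, hodd v hv, PiLp.neg_apply, abs_neg]
      split_ifs <;> rfl
    have h2 := (hlab (-v) hK).2
    have h3 := (hlab v hv).2
    have h4 := (hlab v hv).1
    rw [h1, hodd v hv] at h2
    refine Prod.ext h1 ?_
    simp only [fl]
    rw [h2, h3]
    simp only [PiLp.neg_apply]
    by_cases hp : 0 < g v (lam v).1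
    · have : ¬ (0 < - g v (lam v).1) := by linarith
      simp [hp, hp.le]
    · have hp' := not_lt.1 hp
      rw [abs_of_nonpos hp'] at h4
      have : 0 < - g v (lam v).1 := by linarith
      have h5 : g v (lam v).1 < 0 := by linarith
      simp [hp', h5]
  · intro u hu v hv huv heq
    have hd := huc u hu v hv huv
    obtain ⟨u1, u2⟩ := hlab u hu
    obtain ⟨v1, v2⟩ := hlab v hv
    have e1 : (lam u).1 = (lam v).1 := by rw [heq]; rfl
    have e2 : (lam u).2 = !(lam v).2 := by rw [heq]; rfl
    rw [e1] at u1 u2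
    set i := (lam v).1
    have hi : |g u i - g v i| ≤ dist (g u) (g v) := by
      rw [dist_eq_norm]
      have := PiLp.norm_apply_le (g u - g v) i
      simpa using this
    have hi2 := abs_le.1 (hi.trans hd.le)
    have hi3 := abs_lt.1 (hi.trans_lt hd)
    rw [u2, v2] at e2
    by_cases hp : 0 < g v i
    · have hq : ¬ 0 < g u i := by simpa [hp] using e2
      rw [abs_of_pos hp] at v1
      rw [abs_of_nonpos (not_lt.1 hq)] at u1
      linarith
    · have hq : 0 < g u i := by simpa [hp] using e2
      rw [abs_of_pos hq] at u1
      rw [abs_of_nonpos (not_lt.1 hp)] at v1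
      linarith

abbrev S3 := Metric.sphere (0 : EuclideanSpace ℝ (Fin 4)) 1

open Classical in
noncomputable def nrm (v : E) : S3 :=
  if h : v = 0 then ⟨e 0, by simp [e_norm 0 (by norm_num)]⟩ else
    ⟨‖v‖⁻¹ • v, by simp [norm_smul, h]⟩

lemma nrm_coe (v : E) (h : v ≠ 0) : (nrm v : E) = ‖v‖⁻¹ • v := by simp [nrm, h]

lemma nrm_sphere (p : S3) : nrm (p : E) = p := by
  have hp : ‖(p : E)‖ = 1 := by simpa using p.2
  have : (p : E) ≠ 0 := by rw [← norm_pos_iff, hp]; norm_num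
  apply Subtype.ext
  rw [nrm_coe _ this, hp]; simp

lemma nrm_neg (v : E) (h : v ≠ 0) : nrm (-v) = - nrm v := by
  apply Subtype.ext
  rw [nrm_coe _ (neg_ne_zero.2 h)]
  have : ((- nrm v : S3) : E) = - (nrm v : E) := rfl
  rw [this, nrm_coe _ h]; simp

lemma nrm_cont : ContinuousOn nrm {v : E | v ≠ 0} := by
  rw [Topology.IsInducing.subtypeVal.continuousOn_iff]
  have : ContinuousOn (fun v : E => ‖v‖⁻¹ • v) {v : E | v ≠ 0} := by
    refine ContinuousOn.smul (f := fun v : E => ‖v‖⁻¹) (g := fun v : E => v) ?_ continuousOn_id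
    exact continuous_norm.continuousOn.inv₀ (fun v hv => norm_ne_zero_iff.2 hv)
  exact this.congr (fun v hv => nrm_coe v hv)

theorem borsuk_ulam (f : S3 → E3) (hf : Continuous f) (hodd : ∀ p, f (-p) = -f p) :
    ∃ p : S3, f p = 0 := by
  by_contra! hne
  have hK : ∀ v ∈ K, v ≠ 0 := by
    rintro v ⟨h1, -⟩ rfl
    norm_num at h1
  refine no_map (fun v => f (nrm v)) ?_ ?_ (fun v _ => hne _)
  · exact hf.comp_continuousOn (nrm_cont.mono hK)
  · intro v hv
    rw [nrm_neg v (hK v hv), hodd]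

lemma nrm_par (u v : E) (hu : u ≠ 0) (hv : v ≠ 0) (h : nrm u = nrm v ∨ nrm u = - nrm v) :
    ∃ a : ℝ, u = a • v := by
  have hu' : ‖u‖ ≠ 0 := norm_ne_zero_iff.2 hu
  have e1 : u = ‖u‖ • (nrm u : E) := by
    rw [nrm_coe u hu, smul_smul, mul_inv_cancel₀ hu', one_smul]
  rcases h with h | h
  · refine ⟨‖u‖ * ‖v‖⁻¹, ?_⟩
    rw [mul_smul, ← nrm_coe v hv, ← h, ← e1]
  · refine ⟨-(‖u‖ * ‖v‖⁻¹), ?_⟩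
    have : (nrm u : E) = - (nrm v : E) := by rw [h]; rfl
    rw [neg_smul, mul_smul, ← nrm_coe v hv, ← smul_neg, ← this, ← e1]

open scoped RealInnerProductSpace

lemma second (f : S3 → E3) (hf : Continuous f) (hodd : ∀ p, f (-p) = -f p)
    (H : ∀ p q : S3, f p = f q → p = q ∨ p = -q) : False := by
  have : Nonempty S3 := ⟨nrm 0⟩
  obtain ⟨N, hN⟩ := hf.norm.exists_forall_ge_of_hasCompactSupport
    (HasCompactSupport.of_compactSpace _)
  have hN1 : ‖(N : E)‖ = 1 := by simpa using N.2
  have hNN : ⟪(N : E), (N : E)⟫ = 1 := by rw [real_inner_self_eq_norm_sq, hN1]; norm_num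
  have hfN : f N ≠ 0 := by
    intro h0
    have hz : ∀ p, f p = 0 := fun p => by
      have := hN p
      rw [h0, norm_zero] at this
      exact norm_le_zero_iff.1 this
    have he : ∀ k < 4, e k ≠ 0 := fun k hk h => by
      have := e_norm k hk
      rw [h] at this; simp at this
    obtain ⟨a, ha⟩ := nrm_par (e 0) (e 1) (he 0 (by norm_num)) (he 1 (by norm_num))
      (H _ _ (by rw [hz, hz]))
    have := congrArg (fun v : E => v 0) ha
    simp [e_apply] at this
  set n : E := (N : E)
  have hnz : ∀ x : E, ⟪n, x⟫ = 0 → ∀ t : ℝ, n + t • x ≠ 0 := by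
    intro x hx t h
    have : ⟪n, n + t • x⟫ = 1 := by rw [inner_add_right, inner_smul_right, hx, hNN]; simp
    rw [h] at this; simp at this
  set T : E → E3 := fun x => f (nrm (n + (1:ℝ) • x))
    - f (nrm (n + (-(max 0 (2*‖x‖-1))) • x)) - (max 0 (1 - 2*‖x‖)) • f N with hT
  have hTne : ∀ x : E, ⟪n, x⟫ = 0 → T x ≠ 0 := by
    intro x hx h0
    simp only [hT] at h0
    by_cases hr : ‖x‖ < 1/2
    · rw [max_eq_left (by linarith), max_eq_right (by linarith)] at h0
      have : nrm (n + (-(0:ℝ)) • x) = N := by simpa [n] using nrm_sphere N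
      rw [this, sub_sub, sub_eq_zero] at h0
      have h3 := hN (nrm (n + (1:ℝ) • x))
      have h4 : f N + (1 - 2*‖x‖) • f N = (2 - 2*‖x‖) • f N := by
        rw [show (2 - 2*‖x‖) = 1 + (1 - 2*‖x‖) by ring, add_smul, one_smul]
      rw [h0, h4, norm_smul, Real.norm_of_nonneg (by linarith)] at h3
      have := norm_pos_iff.2 hfN
      nlinarith
    · push Not at hr
      rw [max_eq_right (by linarith), max_eq_left (by linarith), zero_smul, sub_zero,
        sub_eq_zero] at h0
      obtain ⟨a, ha⟩ := nrm_par _ _ (hnz x hx _) (hnz x hx _) (H _ _ h0)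
      have h1 := congrArg (fun v => ⟪n, v⟫) ha
      simp only [inner_add_right, inner_smul_right, hx, hNN] at h1
      have ha1 : a = 1 := by linarith
      rw [ha1, one_smul, one_smul, add_right_inj] at ha
      have h2 : (2*‖x‖) • x = 0 := by
        rw [show 2*‖x‖ = 1 - (-(2*‖x‖-1)) by ring, sub_smul, ← ha, one_smul, sub_self]
      rcases smul_eq_zero.1 h2 with h | h
      · linarith
      · rw [h] at hr; norm_num at hr
  have hTeq : ∀ x : E, ‖x‖ = 1 → T (-x) = - T x := by
    intro x hx
    simp only [hT, norm_neg, hx]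
    norm_num
  set P : S3 → E := fun q => (q : E) - ⟪n, (q : E)⟫ • n with hP
  have hPn : ∀ q, ⟪n, P q⟫ = 0 := by
    intro q
    simp only [hP, inner_sub_right, inner_smul_right, hNN]; ring
  have hPneg : ∀ q, P (-q) = - P q := by
    intro q
    have : ((-q : S3) : E) = - (q : E) := rfl
    simp only [hP, this, inner_neg_right, neg_smul]; abel
  have hP1 : ∀ q : S3, ⟪n, (q : E)⟫ = 0 → ‖P q‖ = 1 := by
    intro q hq
    have h2 : ‖(q : E)‖ = 1 := by simpa using q.2
    simp only [hP, hq, zero_smul, sub_zero, h2]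
  have hPc : Continuous P := by
    simp only [hP]; fun_prop
  have hTc : ∀ R : S3 → E, Continuous R → (∀ q, ⟪n, R q⟫ = 0) → Continuous (fun q => T (R q)) := by
    intro R hR hR0
    have hc : ∀ t : S3 → ℝ, Continuous t → Continuous (fun q => f (nrm (n + t q • R q))) := by
      intro t ht
      apply hf.comp
      refine nrm_cont.comp_continuous (by fun_prop) (fun q => hnz _ (hR0 q) _)
    simp only [hT]
    refine ((hc _ continuous_const).sub (hc (fun q => -(max 0 (2*‖R q‖-1))) (by fun_prop))).sub ?_
    fun_prop
  set F : S3 → E3 := fun q => if 0 ≤ ⟪n, (q : E)⟫ then T (P q) else - T (- P q) with hF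
  have hFc : Continuous F := by
    refine Continuous.if_le (hTc P hPc hPn) (hTc (fun q => - P q) hPc.neg
      (fun q => by rw [inner_neg_right, hPn, neg_zero])).neg continuous_const (by fun_prop) ?_
    intro q hq
    rw [hTeq _ (hP1 q hq.symm), neg_neg]
  have hFodd : ∀ q, F (-q) = - F q := by
    intro q
    have h1 : ((-q : S3) : E) = - (q : E) := rfl
    simp only [hF, hPneg, h1, inner_neg_right]
    rcases lt_trichotomy ⟪n, (q : E)⟫ 0 with h | h | h
    · rw [if_pos (by linarith), if_neg (by linarith), neg_neg]
    · rw [if_pos (by linarith), if_pos (by linarith), hTeq _ (hP1 q h)]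
    · rw [if_neg (by linarith), if_pos (by linarith), neg_neg]
  obtain ⟨q, hq⟩ := borsuk_ulam F hFc hFodd
  simp only [hF] at hq
  split_ifs at hq
  · exact hTne _ (hPn q) hq
  · exact hTne _ (by rw [inner_neg_right, hPn, neg_zero]) (neg_eq_zero.1 hq)

end BU

theorem stmt_17
    (f : Metric.sphere (0 : EuclideanSpace ℝ (Fin 4)) 1 → EuclideanSpace ℝ (Fin 3))
    (hf : Continuous f) (hodd : ∀ p, f (-p) = -f p) :
    (∃ p : Metric.sphere (0 : EuclideanSpace ℝ (Fin 4)) 1, f p = 0) ∧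
    (∃ p₁ p₂ : Metric.sphere (0 : EuclideanSpace ℝ (Fin 4)) 1,
      p₁ ≠ p₂ ∧ p₁ ≠ -p₂ ∧ f p₁ = f p₂) := by
  refine ⟨BU.borsuk_ulam f hf hodd, ?_⟩
  by_contra hcon
  apply BU.second f hf hodd
  intro p q hpq
  by_contra h
  rw [not_or] at h
  exact hcon ⟨p, q, h.1, h.2, hpq⟩
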